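/- arXiv:2311.05897 — 2 statements merged into one kernel-verified Lean document; each statement's English description precedes it below -/
import Mathlib

section
/- Let a_0, a_1, …, a_n ∈ C[x] with a_n ≠ 0, gcd(a_0, a_1, …, a_n) = 1, and deg(a_0) > deg(a_i) - i for all i = 1, 2, …, n. Let L be the monic operator D^n + (a_{n-1}/a_n) D^{n-1} + ⋯ + (a_0/a_n). Then Sind(L) ≤ deg(a_0); more precisely, for every integer s ≥ 0, L*(a_n·x^s) is a polynomial of degree deg(a_0) + s. -/
open Polynomial

/-- The derivative of a rational function, computed via the quotient rule on the
reduced numerator/denominator representation. -/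
noncomputable def rderiv {C : Type} [Field C] (f : RatFunc C) : RatFunc C :=
  algebraMap (Polynomial C) (RatFunc C)
      (derivative f.num * f.denom - f.num * derivative f.denom) /
    algebraMap (Polynomial C) (RatFunc C) (f.denom ^ 2)

/-- The adjoint of the operator `L = Σ_{i=0}^n a_i D^i` applied to `r`:
`L*(r) = Σ_{i=0}^n (-1)^i (a_i * r)^{(i)}`. -/
noncomputable def adjOp {C : Type} [Field C] (n : ℕ) (a : ℕ → RatFunc C)
    (r : RatFunc C) : RatFunc C :=
  ∑ i ∈ Finset.range (n + 1), (-1 : RatFunc C) ^ i * rderiv^[i] (a i * r)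

/-- The stability index of an operator with adjoint action `adj` on `C(x)`: the minimal
`m` such that for every `i ≥ m` there is a polynomial of degree `i` in the image of the
adjoint on `C(x)`. -/
noncomputable def sindOf {C : Type} [Field C] (adj : RatFunc C → RatFunc C) : ℕ :=
  sInf {m : ℕ | ∀ i : ℕ, m ≤ i → ∃ p : Polynomial C, p.degree = (i : ℕ) ∧
    ∃ r : RatFunc C, adj r = algebraMap (Polynomial C) (RatFunc C) p}

theorem rderiv_algebraMap {C : Type} [Field C] (p : C[X]) :
    rderiv (algebraMap C[X] (RatFunc C) p) = algebraMap C[X] (RatFunc C) (derivative p) := by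
  simp [rderiv]

theorem rderiv_iterate_algebraMap {C : Type} [Field C] (k : ℕ) (p : C[X]) :
    rderiv^[k] (algebraMap C[X] (RatFunc C) p) =
      algebraMap C[X] (RatFunc C) (derivative^[k] p) :=
  ((Function.Semiconj.iterate_right (f := algebraMap C[X] (RatFunc C))
    (fun p => (rderiv_algebraMap p).symm) k) p).symm

theorem degree_iterate_derivative_lt {R : Type*} [CommRing R] {p : R[X]} {k N : ℕ}
    (h : p.natDegree < N + k) : (derivative^[k] p).degree < N := by
  rw [degree_lt_iff_coeff_zero]
  intro m hm
  rw [coeff_iterate_derivative, coeff_eq_zero_of_natDegree_lt (by omega), smul_zero]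

/-- The polynomial `Σ_{i=0}^n (-1)^i (a_i q)^{(i)}`. -/
noncomputable def polyAdj {C : Type} [Field C] (n : ℕ) (a : ℕ → C[X]) (q : C[X]) : C[X] :=
  ∑ i ∈ Finset.range (n + 1), (-1) ^ i * derivative^[i] (a i * q)

theorem adjOp_div_mul_algebraMap {C : Type} [Field C] (n : ℕ) (a : ℕ → C[X]) {b : C[X]}
    (hb : b ≠ 0) (q : C[X]) :
    adjOp n (fun i => algebraMap C[X] (RatFunc C) (a i) / algebraMap C[X] (RatFunc C) b)
      (algebraMap C[X] (RatFunc C) b * algebraMap C[X] (RatFunc C) q) =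
      algebraMap C[X] (RatFunc C) (polyAdj n a q) := by
  have hb' : algebraMap C[X] (RatFunc C) b ≠ 0 := RatFunc.algebraMap_ne_zero hb
  simp only [adjOp, polyAdj, map_sum, map_mul, map_pow, map_neg, map_one]
  refine Finset.sum_congr rfl fun i _ => ?_
  rw [← mul_assoc, div_mul_cancel₀ _ hb', ← map_mul, rderiv_iterate_algebraMap]

theorem degree_polyAdj_X_pow {C : Type} [Field C] (n : ℕ) (a : ℕ → C[X]) (ha0 : a 0 ≠ 0)
    (hdeg : ∀ i : ℕ, 1 ≤ i → i ≤ n →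
      ((a i).natDegree : ℤ) - (i : ℤ) < ((a 0).natDegree : ℤ)) (s : ℕ) :
    (polyAdj n a (X ^ s)).degree = ((a 0).natDegree + s : ℕ) := by
  have h0 : (a 0 * X ^ s : C[X]).degree = (((a 0).natDegree + s : ℕ) : WithBot ℕ) := by
    rw [degree_mul, degree_X_pow, degree_eq_natDegree ha0, Nat.cast_add]
  rw [polyAdj, Finset.sum_range_succ', pow_zero, one_mul, Function.iterate_zero_apply,
    degree_add_eq_right_of_degree_lt, h0]
  rw [h0, ← mem_degreeLT]
  refine Submodule.sum_mem _ fun i hi => ?_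
  rw [mem_degreeLT, degree_mul, degree_pow, degree_neg, degree_one, nsmul_zero, zero_add]
  apply degree_iterate_derivative_lt
  have hlt := hdeg (i + 1) (by omega) (by have := Finset.mem_range.mp hi; omega)
  have hle := natDegree_mul_le (p := a (i + 1)) (q := X ^ s)
  rw [natDegree_X_pow] at hle
  push_cast at hlt
  omega

/-- Lemma 4.2. Let `a_0, …, a_n ∈ C[x]` with `a_n ≠ 0`,
`gcd(a_0, …, a_n) = 1` and `deg(a_0) > deg(a_i) - i` for `i = 1, …, n`. For the monic
operator `L = D^n + (a_{n-1}/a_n) D^{n-1} + ⋯ + a_0/a_n` one has `Sind(L) ≤ deg(a_0)`;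
more precisely `L*(a_n x^s)` is a polynomial of degree `deg(a_0) + s` for every `s ≥ 0`. -/
theorem sind_bound_of_degree_condition {C : Type} [Field C] [IsAlgClosed C] [CharZero C]
    (n : ℕ) (a : ℕ → Polynomial C) (ha0 : a 0 ≠ 0) (han : a n ≠ 0)
    (hgcd : ∀ d : Polynomial C, (∀ i : ℕ, i ≤ n → d ∣ a i) → IsUnit d)
    (hdeg : ∀ i : ℕ, 1 ≤ i → i ≤ n →
      ((a i).natDegree : ℤ) - (i : ℤ) < ((a 0).natDegree : ℤ)) :
    sindOf (adjOp n fun i => algebraMap (Polynomial C) (RatFunc C) (a i) /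
        algebraMap (Polynomial C) (RatFunc C) (a n)) ≤ (a 0).natDegree ∧
    ∀ s : ℕ, ∃ p : Polynomial C, p.degree = ((a 0).natDegree + s : ℕ) ∧
      adjOp n (fun i => algebraMap (Polynomial C) (RatFunc C) (a i) /
          algebraMap (Polynomial C) (RatFunc C) (a n))
        (algebraMap (Polynomial C) (RatFunc C) (a n) * RatFunc.X ^ s) =
        algebraMap (Polynomial C) (RatFunc C) p := by
  have key (s : ℕ) := adjOp_div_mul_algebraMap n a han (X ^ s)
  simp only [map_pow, RatFunc.algebraMap_X] at key
  have hd := degree_polyAdj_X_pow n a ha0 hdeg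
  refine ⟨Nat.sInf_le fun i hi => ?_, fun s => ⟨_, hd s, key s⟩⟩
  obtain ⟨s, rfl⟩ := Nat.exists_eq_add_of_le hi
  exact ⟨_, hd s, _, key s⟩
end

section
/- Let f ∈ C(x) and let h ∈ C[x] be a nonzero polynomial. If the operator L = D + f is stable, then the operator D + f - h'/h is also stable. -/
open Polynomial

/-- The adjoint of the first-order operator `D + f` applied to `r`: `L*(r) = -r' + f*r`. -/
noncomputable def adjD {C : Type} [Field C] (f r : RatFunc C) : RatFunc C :=
  -rderiv r + f * r

/-- A linear differential operator with adjoint action `adj` on `C(x)` is stable if for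
every `i ≥ 0` there is a polynomial of degree `i` in the image of the adjoint on `C(x)`. -/
def stableOf {C : Type} [Field C] (adj : RatFunc C → RatFunc C) : Prop :=
  ∀ i : ℕ, ∃ p : Polynomial C, p.degree = (i : ℕ) ∧
    ∃ r : RatFunc C, adj r = algebraMap (Polynomial C) (RatFunc C) p

section RationalDerivative

variable {C : Type} [Field C]

local notation "ι" => algebraMap (Polynomial C) (RatFunc C)

/-- The quotient rule holds for every, not necessarily reduced, representation. -/
theorem rderiv_div (p q : Polynomial C) (hq : q ≠ 0) :
    rderiv (ι p / ι q) = ι (derivative p * q - p * derivative q) / ι (q ^ 2) := by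
  set g := ι p / ι q with hg
  have hd : g.denom ≠ 0 := g.denom_ne_zero
  have e₁ : g.num * q = p * g.denom := (RatFunc.num_mul_eq_mul_denom_iff hq).2 hg
  have e₂ := congrArg derivative e₁
  simp only [derivative_mul] at e₂
  rw [rderiv, div_eq_div_iff (RatFunc.algebraMap_ne_zero (pow_ne_zero 2 hd))
    (RatFunc.algebraMap_ne_zero (pow_ne_zero 2 hq)), ← map_mul, ← map_mul]
  congr 1
  linear_combination (g.denom * q) * e₂ - (derivative q * g.denom + derivative g.denom * q) * e₁

theorem rderiv_add (r s : RatFunc C) : rderiv (r + s) = rderiv r + rderiv s := by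
  induction r using RatFunc.induction_on with | _ p q hq =>
  induction s using RatFunc.induction_on with | _ a b hb =>
  have hq' : ι q ≠ 0 := RatFunc.algebraMap_ne_zero hq
  have hb' : ι b ≠ 0 := RatFunc.algebraMap_ne_zero hb
  rw [div_add_div _ _ hq' hb', ← map_mul, ← map_mul, ← map_mul, ← map_add,
    rderiv_div _ _ (mul_ne_zero hq hb), rderiv_div _ _ hq, rderiv_div _ _ hb]
  simp only [derivative_mul, map_sub, map_add, map_mul, map_pow]
  field_simp
  ring

theorem rderiv_mul (r s : RatFunc C) : rderiv (r * s) = rderiv r * s + r * rderiv s := by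
  induction r using RatFunc.induction_on with | _ p q hq =>
  induction s using RatFunc.induction_on with | _ a b hb =>
  have hq' : ι q ≠ 0 := RatFunc.algebraMap_ne_zero hq
  have hb' : ι b ≠ 0 := RatFunc.algebraMap_ne_zero hb
  rw [div_mul_div_comm, ← map_mul, ← map_mul,
    rderiv_div _ _ (mul_ne_zero hq hb), rderiv_div _ _ hq, rderiv_div _ _ hb]
  simp only [derivative_mul, map_sub, map_add, map_mul, map_pow]
  field_simp
  ring

theorem rderiv_algebraMap_s8 (p : Polynomial C) : rderiv (ι p) = ι (derivative p) := by
  simpa using rderiv_div p 1 one_ne_zero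

theorem adjD_add (f r s : RatFunc C) : adjD f (r + s) = adjD f r + adjD f s := by
  simp only [adjD, rderiv_add]
  ring

theorem adjD_C_mul (f r : RatFunc C) (c : C) :
    adjD f (ι (Polynomial.C c) * r) = ι (Polynomial.C c) * adjD f r := by
  simp only [adjD, rderiv_mul, rderiv_algebraMap_s8, derivative_C, map_zero]
  ring

/-- The polynomials in the image of the adjoint of `D + f`. -/
def adjDPolynomials (f : RatFunc C) : Submodule C (Polynomial C) where
  carrier := {p | ∃ r, adjD f r = ι p}
  add_mem' := by
    rintro p q ⟨r, hr⟩ ⟨s, hs⟩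
    exact ⟨r + s, by rw [adjD_add, hr, hs, map_add]⟩
  zero_mem' := ⟨0, by simpa using adjD_C_mul f 0 0⟩
  smul_mem' := by
    rintro c p ⟨r, hr⟩
    exact ⟨ι (Polynomial.C c) * r, by rw [adjD_C_mul, hr, ← map_mul, smul_eq_C_mul]⟩

/-- If `D + f` is stable, every polynomial lies in the image of its adjoint. -/
theorem exists_adjD_eq_of_stableOf {f : RatFunc C} (hf : stableOf (adjD f))
    (p : Polynomial C) : ∃ r, adjD f r = ι p := by
  choose P hdeg hmem using hf
  let S : Polynomial.Sequence C := ⟨P, hdeg⟩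
  have hspan : Submodule.span C (Set.range S) = ⊤ :=
    S.span fun i => (leadingCoeff_ne_zero.2 (S.ne_zero i)).isUnit
  have hle : Submodule.span C (Set.range S) ≤ adjDPolynomials f :=
    Submodule.span_le.2 (Set.range_subset_iff.2 hmem)
  exact hle (hspan ▸ Submodule.mem_top)

/-- Subtracting the logarithmic derivative of `h` divides the image of the adjoint by `h`. -/
theorem adjD_sub_logDeriv_div (f r : RatFunc C) {h : Polynomial C} (hh : h ≠ 0) :
    adjD (f - ι (derivative h) / ι h) (r / ι h) = adjD f r / ι h := by
  have hι : ι h ≠ 0 := RatFunc.algebraMap_ne_zero hh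
  have hr := rderiv_mul (r / ι h) (ι h)
  rw [div_mul_cancel₀ r hι, rderiv_algebraMap_s8] at hr
  rw [adjD, adjD, hr]
  field_simp
  ring

end RationalDerivative

/-- Proposition 4.7. If `L = D + f` is stable and `h ∈ C[x]` is a
nonzero polynomial, then `D + f - h'/h` is stable. -/
theorem stable_sub_logderiv {C : Type} [Field C] [IsAlgClosed C] [CharZero C]
    (f : RatFunc C) (h : Polynomial C) (hh : h ≠ 0) (hst : stableOf (adjD f)) :
    stableOf (adjD (f - algebraMap (Polynomial C) (RatFunc C) (derivative h) /
      algebraMap (Polynomial C) (RatFunc C) h)) := by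
  intro i
  obtain ⟨r, hr⟩ := exists_adjD_eq_of_stableOf hst (X ^ i * h)
  refine ⟨X ^ i, degree_X_pow i, r / algebraMap (Polynomial C) (RatFunc C) h, ?_⟩
  rw [adjD_sub_logDeriv_div f r hh, hr, map_mul,
    mul_div_cancel_right₀ _ (RatFunc.algebraMap_ne_zero hh)]
end
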